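/- arXiv:math/0010203 — 2 statements merged into one kernel-verified Lean document; each statement's English description precedes it below -/
import Mathlib

section
/- Let f : ℝⁿ → ℂᵏ be a map that is real-analytic at 0 (i.e. analytic over ℝ in a neighbourhood of 0 in ℝⁿ). Then there exists an open neighbourhood U' of 0 in ℂⁿ and a map g : ℂⁿ → ℂᵏ that is complex-analytic (holomorphic) on U' such that g(ι(x)) = f(x) for all x ∈ ℝⁿ with ι(x) ∈ U', where ι : ℝⁿ → ℂⁿ is the componentwise inclusion x ↦ (x₁, …, xₙ) regarding each real coordinate as a complex number. -/
/-- Componentwise inclusion of `ℝⁿ` into `ℂⁿ`. -/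
def incl (n : ℕ) (x : Fin n → ℝ) : Fin n → ℂ := fun i => (x i : ℂ)

namespace FormalMultilinearSeries

open scoped NNReal ENNReal

variable {ι F : Type*} [Fintype ι] [DecidableEq ι] [NormedAddCommGroup F] [NormedSpace ℂ F]
  [NormedSpace ℝ F]

/-- The complexification of a formal multilinear series on `ι → ℝ` with values in a complex normed
space: each term is extended `ℂ`-multilinearly from its values on the standard basis. -/
noncomputable def complexify (p : FormalMultilinearSeries ℝ (ι → ℝ) F) :
    FormalMultilinearSeries ℂ (ι → ℂ) F := fun m =>
  ∑ r : Fin m → ι,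
    (ContinuousMultilinearMap.mkPiRing ℂ (Fin m)
      (p m fun i => Pi.single (r i) 1)).compContinuousLinearMap
        fun i => ContinuousLinearMap.proj (R := ℂ) (φ := fun _ : ι => ℂ) (r i)

theorem complexify_apply (p : FormalMultilinearSeries ℝ (ι → ℝ) F) (m : ℕ)
    (v : Fin m → ι → ℂ) :
    p.complexify m v = ∑ r : Fin m → ι, (∏ i, v i (r i)) • p m fun i => Pi.single (r i) 1 := by
  simp [complexify]

theorem complexify_apply_ofReal [IsScalarTower ℝ ℂ F] (p : FormalMultilinearSeries ℝ (ι → ℝ) F)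
    (m : ℕ) (v : Fin m → ι → ℝ) :
    (p.complexify m fun i j => (v i j : ℂ)) = p m v := by
  have hv : v = fun i => ∑ j, v i j • (Pi.single j 1 : ι → ℝ) :=
    funext fun i => pi_eq_sum_univ' (v i)
  conv_rhs => rw [hv, ContinuousMultilinearMap.map_sum]
  rw [complexify_apply]
  refine Finset.sum_congr rfl fun r _ => ?_
  rw [ContinuousMultilinearMap.map_smul_univ, ← Complex.ofReal_prod, ← Complex.coe_algebraMap,
    algebraMap_smul]

theorem norm_complexify_le (p : FormalMultilinearSeries ℝ (ι → ℝ) F) (m : ℕ) :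
    ‖p.complexify m‖ ≤ (Fintype.card ι : ℝ) ^ m * ‖p m‖ := by
  refine ContinuousMultilinearMap.opNorm_le_bound (by positivity) fun v => ?_
  rw [complexify_apply]
  have hterm (r : Fin m → ι) :
      ‖(∏ i, v i (r i)) • p m fun i => Pi.single (r i) 1‖ ≤ ‖p m‖ * ∏ i, ‖v i‖ := by
    rw [norm_smul, norm_prod, mul_comm]
    gcongr
    · simpa [Pi.norm_single] using (p m).le_opNorm fun i => Pi.single (r i) 1
    · exact norm_le_pi_norm _ _
  calc _ ≤ ∑ _r : Fin m → ι, ‖p m‖ * ∏ i, ‖v i‖ := norm_sum_le_of_le _ fun r _ => hterm r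
    _ = _ := by simp [mul_assoc]

theorem complexify_radius_pos {p : FormalMultilinearSeries ℝ (ι → ℝ) F} (hp : 0 < p.radius) :
    0 < p.complexify.radius := by
  obtain ⟨s, hs, hsp⟩ := ENNReal.lt_iff_exists_nnreal_btwn.1 hp
  obtain ⟨C, -, hC⟩ := p.norm_mul_pow_le_of_lt_radius hsp
  have hs : 0 < s := by exact_mod_cast hs
  set t : ℝ≥0 := s / (Fintype.card ι + 1)
  have ht : 0 < t := by positivity
  have hts : (Fintype.card ι : ℝ) * t ≤ s := by
    have h : ((Fintype.card ι : ℝ) + 1) * t = s := by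
      simp only [t]
      push_cast
      field_simp
    nlinarith [t.coe_nonneg]
  refine lt_of_lt_of_le (ENNReal.coe_pos.2 ht) (p.complexify.le_radius_of_bound C fun m => ?_)
  calc ‖p.complexify m‖ * (t : ℝ) ^ m
      ≤ (Fintype.card ι : ℝ) ^ m * ‖p m‖ * (t : ℝ) ^ m := by
        gcongr
        exact p.norm_complexify_le m
    _ = ‖p m‖ * ((Fintype.card ι : ℝ) * t) ^ m := by ring
    _ ≤ ‖p m‖ * (s : ℝ) ^ m := by gcongr
    _ ≤ C := hC m

end FormalMultilinearSeries

theorem enorm_incl (n : ℕ) (x : Fin n → ℝ) : ‖incl n x‖ₑ = ‖x‖ₑ := by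
  simp [enorm, Pi.nnnorm_def, incl]

/-- A map `f : ℝⁿ → ℂᵏ` which is real-analytic at `0` extends to a map holomorphic on a
neighbourhood `U'` of `0` in `ℂⁿ`. -/
theorem holomorphic_extension_of_realAnalytic (n k : ℕ)
    (f : (Fin n → ℝ) → (Fin k → ℂ)) (hf : AnalyticAt ℝ f 0) :
    ∃ (U' : Set (Fin n → ℂ)) (g : (Fin n → ℂ) → (Fin k → ℂ)),
      IsOpen U' ∧ (0 : Fin n → ℂ) ∈ U' ∧ AnalyticOnNhd ℂ g U' ∧
      ∀ x : Fin n → ℝ, incl n x ∈ U' → g (incl n x) = f x := by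
  obtain ⟨p, R, hp⟩ := hf
  have hq := p.complexify.hasFPowerSeriesOnBall
    (FormalMultilinearSeries.complexify_radius_pos (hp.r_pos.trans_le hp.r_le))
  refine ⟨Metric.eball 0 (min R p.complexify.radius), p.complexify.sum, Metric.isOpen_eball,
    Metric.mem_eball_self (lt_min hp.r_pos hq.r_pos),
    hq.analyticOnNhd.mono (Metric.eball_subset_eball (min_le_right _ _)), fun x hx => ?_⟩
  have hxR : x ∈ Metric.eball (0 : Fin n → ℝ) R := by
    rw [Metric.mem_eball, edist_zero_right] at hx ⊢
    exact enorm_incl n x ▸ hx.trans_le (min_le_left _ _)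
  calc p.complexify.sum (incl n x) = p.sum x :=
        tsum_congr fun m => p.complexify_apply_ofReal m fun _ => x
    _ = f x := by simpa using (hp.sum hxR).symm
end

section
/- Let f : ℝⁿ → ℂⁿ be real-analytic at 0, suppose its derivative Df(0) : ℝⁿ → ℂⁿ (an ℝ-linear map) is injective, and suppose the image Df(0)(ℝⁿ) is totally real in ℂⁿ, i.e. Df(0)(ℝⁿ) ∩ (i·Df(0)(ℝⁿ)) = {0}. Let φ : ℂⁿ → ℂⁿ be a holomorphic map on a neighbourhood of 0 in ℂⁿ with φ(ι(x)) = f(x) for all x near 0 in ℝⁿ, where ι : ℝⁿ → ℂⁿ is the componentwise inclusion. Then φ is a local biholomorphism at 0: there are open neighbourhoods U of 0 and U' of f(0) in ℂⁿ such that φ restricts to a bijection from U onto U' whose inverse is holomorphic on U'. -/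
open Set Filter Topology

/-- An analytic map whose derivative at a point is invertible restricts to a bijection between open
neighbourhoods with analytic inverse. -/
theorem AnalyticAt.exists_bijOn_analyticOnNhd_inverse {𝕜 E F : Type*} [RCLike 𝕜]
    [NormedAddCommGroup E] [NormedSpace 𝕜 E] [CompleteSpace E]
    [NormedAddCommGroup F] [NormedSpace 𝕜 F] [CompleteSpace F]
    {φ : E → F} {a : E} (hφ : AnalyticAt 𝕜 φ a) (e : E ≃L[𝕜] F)
    (he : (e : E →L[𝕜] F) = fderiv 𝕜 φ a) :
    ∃ (U : Set E) (U' : Set F), IsOpen U ∧ IsOpen U' ∧ a ∈ U ∧ φ a ∈ U' ∧ BijOn φ U U' ∧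
      ∃ ψ : F → E, InvOn ψ φ U U' ∧ AnalyticOnNhd 𝕜 ψ U' := by
  have hs : HasStrictFDerivAt φ (e : E →L[𝕜] F) a := he ▸ hφ.hasStrictFDerivAt
  let R := hs.toOpenPartialHomeomorph φ
  have hR : (R : E → F) = φ := hs.toOpenPartialHomeomorph_coe
  have ha : a ∈ R.source := hs.mem_toOpenPartialHomeomorph_source
  have hsymm : AnalyticAt 𝕜 R.symm (R a) :=
    R.analyticAt_symm' ha (by rwa [hR]) (by rw [hR, he])
  let S := (R.symm.restrOpen _ (isOpen_analyticAt 𝕜 R.symm)).symm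
  have hS : (S : E → F) = φ := hR
  have hat : φ a ∈ S.target := by
    rw [← hR]
    exact ⟨R.map_source ha, hsymm⟩
  have has : a ∈ S.source := by
    have h := S.map_target hat
    rwa [← hR, show S.symm (R a) = a from R.left_inv ha] at h
  refine ⟨S.source, S.target, S.open_source, S.open_target, has, hat, hS ▸ S.bijOn,
    S.symm, hS ▸ S.invOn, fun y hy => hy.2⟩

/-- The inclusion of `ℝⁿ` into `ℂⁿ` as a continuous real-linear map. -/
noncomputable def inclCLM (n : ℕ) : (Fin n → ℝ) →L[ℝ] (Fin n → ℂ) :=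
  ContinuousLinearMap.pi fun i => Complex.ofRealCLM.comp (ContinuousLinearMap.proj i)

theorem incl_re_add_I_smul_incl_im {n : ℕ} (z : Fin n → ℂ) :
    incl n (fun i => (z i).re) + Complex.I • incl n (fun i => (z i).im) = z := by
  ext i
  simp [incl, mul_comm Complex.I]

/-- A complex-linear map is injective if its restriction to `ℝⁿ` is injective with totally real
image. -/
theorem injective_of_totallyReal {n : ℕ} {E : Type*} [AddCommGroup E] [Module ℂ E] [Module ℝ E]
    (A : (Fin n → ℂ) →ₗ[ℂ] E) (D : (Fin n → ℝ) →ₗ[ℝ] E) (hAD : ∀ u, A (incl n u) = D u)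
    (hinj : Function.Injective D) (htr : ∀ u v, D u = Complex.I • D v → D u = 0) :
    Function.Injective A := by
  rw [injective_iff_map_eq_zero] at hinj ⊢
  intro z hz
  set u : Fin n → ℝ := fun i => (z i).re
  set v : Fin n → ℝ := fun i => (z i).im
  have hsum : D u + Complex.I • D v = 0 := by
    rw [← hAD, ← hAD, ← map_smul, ← map_add, incl_re_add_I_smul_incl_im, hz]
  have hDu : D u = 0 := by
    apply htr u (-v)
    rw [map_neg, smul_neg]
    exact eq_neg_of_add_eq_zero_left hsum
  have hDv : D v = 0 := by simpa [hDu] using hsum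
  have hu0 := hinj u hDu
  have hv0 := hinj v hDv
  ext i
  exact Complex.ext (congrFun hu0 i) (congrFun hv0 i)


/-- Let `f : ℝⁿ → ℂⁿ` be real-analytic at `0` with `Df(0)` injective and with totally real
image, and let `φ` be a holomorphic map near `0` in `ℂⁿ` with `φ ∘ ι = f` near `0` in `ℝⁿ`.
Then `φ` is a local biholomorphism at `0`: it restricts to a bijection from an open
neighbourhood `U` of `0` onto an open neighbourhood `U'` of `f 0`, with holomorphic inverse. -/
theorem extension_is_local_biholomorphism (n : ℕ)
    (f : (Fin n → ℝ) → (Fin n → ℂ)) (hf : AnalyticAt ℝ f 0)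
    (hinj : Function.Injective (fderiv ℝ f 0))
    (htr : ∀ u v : Fin n → ℝ,
      fderiv ℝ f 0 u = Complex.I • fderiv ℝ f 0 v → fderiv ℝ f 0 u = 0)
    (φ : (Fin n → ℂ) → (Fin n → ℂ))
    (U₀ : Set (Fin n → ℂ)) (hU₀ : IsOpen U₀) (h0U₀ : (0 : Fin n → ℂ) ∈ U₀)
    (hφ : AnalyticOnNhd ℂ φ U₀)
    (W : Set (Fin n → ℝ)) (hW : IsOpen W) (h0W : (0 : Fin n → ℝ) ∈ W)
    (hext : ∀ x ∈ W, φ (incl n x) = f x) :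
    ∃ (U U' : Set (Fin n → ℂ)), IsOpen U ∧ IsOpen U' ∧
      (0 : Fin n → ℂ) ∈ U ∧ f 0 ∈ U' ∧ Set.BijOn φ U U' ∧
      ∃ ψ : (Fin n → ℂ) → (Fin n → ℂ), Set.InvOn ψ φ U U' ∧ AnalyticOnNhd ℂ ψ U' := by
  have hφ0 : AnalyticAt ℂ φ 0 := hφ 0 h0U₀
  have hincl : incl n 0 = 0 := (inclCLM n).map_zero
  have hderiv : ∀ u, fderiv ℂ φ 0 (incl n u) = fderiv ℝ f 0 u := by
    have hφd : HasFDerivAt φ ((fderiv ℂ φ 0).restrictScalars ℝ) (inclCLM n 0) := by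
      rw [map_zero]
      exact hφ0.differentiableAt.hasFDerivAt.restrictScalars ℝ
    have hcomp := hφd.comp 0 (inclCLM n).hasFDerivAt
    have heq : f =ᶠ[𝓝 0] φ ∘ inclCLM n :=
      eventually_of_mem (hW.mem_nhds h0W) fun x hx => (hext x hx).symm
    intro u
    rw [(hcomp.congr_of_eventuallyEq heq).fderiv]
    rfl
  have hker : Function.Injective (fderiv ℂ φ 0) :=
    injective_of_totallyReal (fderiv ℂ φ 0).toLinearMap (fderiv ℝ f 0).toLinearMap hderiv hinj htr
  let e : (Fin n → ℂ) ≃L[ℂ] (Fin n → ℂ) :=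
    (LinearEquiv.ofInjectiveEndo (fderiv ℂ φ 0).toLinearMap hker).toContinuousLinearEquiv
  have h := hφ0.exists_bijOn_analyticOnNhd_inverse e (by ext1; rfl)
  have hφf : φ 0 = f 0 := by rw [← hext 0 h0W, hincl]
  rwa [hφf] at h
end
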